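/- arXiv:1801.00212 — 5 statements merged into one kernel-verified Lean document; each statement's English description precedes it below -/
import Mathlib

section
/- Let h : ℝ² → [0,∞) be Lebesgue integrable. Then for almost every s ∈ [0,1], the sequence of integrals ∫_ℝ h(u, s + k − u) du tends to 0 as k → ±∞ (i.e., along the cofinite filter on ℤ). -/
open MeasureTheory Filter

lemma aux_tendsto (g : ℝ → ℝ) (hg : Integrable g) :
    ∀ᵐ s ∂(volume.restrict (Set.Ioc (0 : ℝ) 1)),
      Tendsto (fun k : ℤ => g (s + k)) cofinite (nhds 0) := by
  have hm : ∀ k : ℤ, AEMeasurable (fun s : ℝ => ‖g (s + k)‖ₑ)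
      (volume.restrict (Set.Ioc (0 : ℝ) 1)) := fun k =>
    ((hg.comp_add_right (k : ℝ)).aestronglyMeasurable.enorm).restrict
  have key : ∫⁻ s in Set.Ioc (0 : ℝ) 1, ∑' k : ℤ, ‖g (s + k)‖ₑ ≠ ⊤ := by
    rw [lintegral_tsum hm]
    have h1 : ∀ k : ℤ, ∫⁻ s in Set.Ioc (0 : ℝ) 1, ‖g (s + k)‖ₑ
        = ∫⁻ s in Set.Ioc (k : ℝ) (k + 1), ‖g s‖ₑ := by
      intro k
      have := (measurePreserving_add_right volume (k : ℝ)).setLIntegral_comp_preimage_emb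
        (measurableEmbedding_addRight (k : ℝ)) (fun x => ‖g x‖ₑ) (Set.Ioc (k : ℝ) (k + 1))
      rw [← this]
      simp
    simp_rw [h1]
    rw [← lintegral_iUnion (fun _ => measurableSet_Ioc)
      (Set.pairwise_disjoint_Ioc_intCast ℝ), iUnion_Ioc_intCast, setLIntegral_univ]
    exact hg.hasFiniteIntegral.ne
  filter_upwards [ae_lt_top' (AEMeasurable.tsum hm) key] with s hs
  have := ENNReal.tendsto_cofinite_zero_of_tsum_ne_top hs.ne
  exact tendsto_zero_iff_enorm_tendsto_zero.2 this

/-- Property (3) of Section 3: for an integrable nonnegative `h` on `ℝ²`, for almost every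
`s ∈ [0,1]` the integrals `∫_ℝ h(u, s + k - u) du` tend to `0` as `k → ±∞` (along the
cofinite filter on `ℤ`). -/
theorem stmt6 (h : ℝ × ℝ → ℝ) (hh0 : ∀ p, 0 ≤ h p) (hint : Integrable h) :
    ∀ᵐ s ∂(volume.restrict (Set.Icc (0 : ℝ) 1)),
      Tendsto (fun k : ℤ => ∫ u : ℝ, h (u, s + k - u)) cofinite (nhds 0) := by
  rw [← restrict_Ioc_eq_restrict_Icc]
  apply aux_tendsto (fun t => ∫ u : ℝ, h (u, t - u))
  have mp := measurePreserving_prod_neg_add_swap (volume : Measure ℝ) (volume : Measure ℝ)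
  have hi := (mp.integrable_comp_of_integrable hint).integral_prod_left
  refine hi.congr (Eventually.of_forall fun t => ?_)
  simp [neg_add_eq_sub]
end

section
/- Let f and g be probability density functions on ℝ with cumulative distribution functions F(x) = ∫_{−∞}^x f and G(y) = ∫_{−∞}^y g, and let c : [0,1]² → [0,∞) be a copula density with ∫_{[0,1]²} |1 − c(u,v)| du dv < ∞. Then for almost every s ∈ [0,1] the sum ∑_{k∈ℤ} ∫_ℝ f(u) g(s + k − u) |1 − c(F(u), G(s + k − u))| du is finite, and ∫₀^1 | ∑_{k∈ℤ} ∫_ℝ f(u) g(s + k − u) ( 1 − c(F(u), G(s + k − u)) ) du | ds ≤ ∫_{[0,1]²} |1 − c(u,v)| du dv. -/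
open MeasureTheory

lemma aux_map_cdf (f F : ℝ → ℝ) (hf : Measurable f) (hf0 : ∀ x, 0 ≤ f x)
    (hf1 : ∫ x, f x = 1) (hF : ∀ x, F x = ∫ u in Set.Iic x, f u) :
    Measurable F ∧ (volume.withDensity (fun x => ENNReal.ofReal (f x))).map F =
      volume.restrict (Set.Icc (0:ℝ) 1) := by
  have hfi : Integrable f := by
    by_contra h
    rw [integral_undef h] at hf1
    exact zero_ne_one hf1
  have hcont : Continuous F := by
    have h : F = fun x => F 0 + ∫ u in (0:ℝ)..x, f u := by
      funext x
      rw [hF x, hF 0, ← intervalIntegral.integral_Iic_sub_Iic hfi.integrableOn hfi.integrableOn]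
      ring
    rw [h]
    exact continuous_const.add (intervalIntegral.continuous_primitive
      (fun a b => hfi.intervalIntegrable) 0)
  set μ := volume.withDensity (fun x => ENNReal.ofReal (f x)) with hμ
  have hμF : ∀ x, μ (Set.Iic x) = ENNReal.ofReal (F x) := by
    intro x
    rw [hμ, withDensity_apply _ measurableSet_Iic, hF x,
      ofReal_integral_eq_lintegral_ofReal hfi.integrableOn (ae_of_all _ hf0)]
  haveI : IsProbabilityMeasure μ := by
    constructor
    rw [hμ, withDensity_apply _ MeasurableSet.univ, Measure.restrict_univ,
      ← ofReal_integral_eq_lintegral_ofReal hfi (ae_of_all _ hf0), hf1, ENNReal.ofReal_one]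
  have hF0 : ∀ x, 0 ≤ F x := fun x => by
    rw [hF x]; exact integral_nonneg hf0
  have hFc : F = ProbabilityTheory.cdf μ := by
    funext x
    rw [ProbabilityTheory.cdf_eq_real, measureReal_def, hμF x, ENNReal.toReal_ofReal (hF0 x)]
  have hmono : Monotone F := by rw [hFc]; exact ProbabilityTheory.monotone_cdf μ
  have hF1 : ∀ x, F x ≤ 1 := fun x => by
    rw [hFc]; exact ProbabilityTheory.cdf_le_one μ x
  have hbot : Filter.Tendsto F Filter.atBot (nhds 0) := by
    rw [hFc]; exact ProbabilityTheory.tendsto_cdf_atBot μ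
  have htop : Filter.Tendsto F Filter.atTop (nhds 1) := by
    rw [hFc]; exact ProbabilityTheory.tendsto_cdf_atTop μ
  have hivt : ∀ t : ℝ, 0 < t → t < 1 → ∃ x, F x = t := by
    intro t h0 h1
    obtain ⟨a, ha⟩ := (hbot.eventually (gt_mem_nhds h0)).exists
    obtain ⟨b, hb⟩ := (htop.eventually (lt_mem_nhds h1)).exists
    exact mem_range_of_exists_le_of_exists_ge hcont ⟨a, ha.le⟩ ⟨b, hb.le⟩
  refine ⟨hcont.measurable, ?_⟩
  haveI : IsProbabilityMeasure (μ.map F) := Measure.isProbabilityMeasure_map hcont.aemeasurable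
  refine Measure.ext_of_Iic _ _ (fun t => ?_)
  rw [Measure.map_apply hcont.measurable measurableSet_Iic,
    Measure.restrict_apply measurableSet_Iic]
  rcases lt_or_ge t 0 with ht | ht
  · have h1 : F ⁻¹' Set.Iic t = ∅ := by
      ext x; simp only [Set.mem_preimage, Set.mem_Iic, Set.mem_empty_iff_false, iff_false, not_le]
      exact lt_of_lt_of_le ht (hF0 x)
    have h2 : Set.Iic t ∩ Set.Icc (0:ℝ) 1 = ∅ := by
      ext x; simp only [Set.mem_inter_iff, Set.mem_Iic, Set.mem_Icc, Set.mem_empty_iff_false,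
        iff_false]
      rintro ⟨h, h', _⟩; linarith
    rw [h1, h2]; simp
  rcases le_or_gt 1 t with ht1 | ht1
  · have h1 : F ⁻¹' Set.Iic t = Set.univ := by
      ext x; simpa using (hF1 x).trans ht1
    have h2 : Set.Iic t ∩ Set.Icc (0:ℝ) 1 = Set.Icc 0 1 := by
      ext x; simp only [Set.mem_inter_iff, Set.mem_Iic, Set.mem_Icc]
      constructor
      · exact fun h => h.2
      · exact fun h => ⟨h.2.trans ht1, h⟩
    rw [h1, h2]; simp
  have h2 : Set.Iic t ∩ Set.Icc (0:ℝ) 1 = Set.Icc 0 t := by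
    ext x; simp only [Set.mem_inter_iff, Set.mem_Iic, Set.mem_Icc]
    constructor
    · exact fun h => ⟨h.2.1, h.1⟩
    · exact fun h => ⟨h.2, h.1, h.2.trans ht1.le⟩
  rw [h2, Real.volume_Icc, sub_zero]
  apply le_antisymm
  · have hlim : Filter.Tendsto (fun y : ℝ => ENNReal.ofReal y) (nhdsWithin t (Set.Ioi t))
        (nhds (ENNReal.ofReal t)) :=
      (ENNReal.continuous_ofReal.tendsto t).mono_left nhdsWithin_le_nhds
    refine ge_of_tendsto hlim ?_
    filter_upwards [Ioo_mem_nhdsGT ht1] with y hy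
    obtain ⟨x, hx⟩ := hivt y (lt_of_le_of_lt ht hy.1) hy.2
    rw [← hx, ← hμF x]
    refine measure_mono (fun z hz => ?_)
    by_contra hzx
    have h3 : F z ≤ t := hz
    have h4 := hmono (le_of_not_ge hzx)
    linarith [hy.1]
  · rcases ht.eq_or_lt with h | h
    · rw [← h]; simp
    · obtain ⟨x, hx⟩ := hivt t h ht1
      calc ENNReal.ofReal t = μ (Set.Iic x) := by rw [hμF x, hx]
        _ ≤ _ := measure_mono (fun z hz => by
          have := hmono (show z ≤ x from hz)
          show F z ≤ t
          linarith)

lemma aux_tile (φ : ℝ → ENNReal) (hφ : Measurable φ) :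
    ∫⁻ s in Set.Ioc (0:ℝ) 1, ∑' k : ℤ, φ (s + k) = ∫⁻ s, φ s := by
  rw [lintegral_tsum (fun k => by fun_prop)]
  rw [← setLIntegral_univ, ← iUnion_Ioc_intCast (α := ℝ),
    lintegral_iUnion (fun k => measurableSet_Ioc) (Set.pairwise_disjoint_Ioc_intCast ℝ)]
  refine tsum_congr (fun k => ?_)
  rw [← (measurePreserving_add_right volume (k:ℝ)).setLIntegral_comp_preimage
    measurableSet_Ioc hφ]
  congr 2
  ext x; simp [add_comm]

/-- Theorem 4.1 (two-dimensional case): for probability density functions `f, g` with CDFs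
`F, G` and a copula density `c` on `[0,1]²` with `∫_{[0,1]²} |1 − c| < ∞`, the sum
`∑_{k ∈ ℤ} ∫_ℝ f(u) g(s+k−u) |1 − c(F(u), G(s+k−u))| du` is finite for almost every
`s ∈ [0,1]`, and the L¹ distance from Benford
`∫₀¹ |∑_{k ∈ ℤ} ∫_ℝ f(u) g(s+k−u) (1 − c(F(u), G(s+k−u))) du| ds` is bounded above by
`∫_{[0,1]²} |1 − c(u,v)| du dv`. -/
theorem stmt11 (f g : ℝ → ℝ) (hf : Measurable f) (hg : Measurable g)
    (hf0 : ∀ x, 0 ≤ f x) (hg0 : ∀ x, 0 ≤ g x)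
    (hf1 : ∫ x, f x = 1) (hg1 : ∫ x, g x = 1)
    (F G : ℝ → ℝ) (hF : ∀ x, F x = ∫ u in Set.Iic x, f u)
    (hG : ∀ y, G y = ∫ v in Set.Iic y, g v)
    (c : ℝ × ℝ → ℝ) (hc : Measurable c) (hc0 : ∀ p, 0 ≤ c p)
    (hmarg1 : ∀ᵐ u ∂(volume.restrict (Set.Icc (0 : ℝ) 1)),
      ∫ v in (0 : ℝ)..1, c (u, v) = 1)
    (hmarg2 : ∀ᵐ v ∂(volume.restrict (Set.Icc (0 : ℝ) 1)),
      ∫ u in (0 : ℝ)..1, c (u, v) = 1)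
    (hcint : IntegrableOn (fun p : ℝ × ℝ => |1 - c p|)
      (Set.Icc (0 : ℝ) 1 ×ˢ Set.Icc (0 : ℝ) 1)) :
    (∀ᵐ s ∂(volume.restrict (Set.Icc (0 : ℝ) 1)),
        Summable fun k : ℤ =>
          ∫ u : ℝ, f u * g (s + k - u) * |1 - c (F u, G (s + k - u))|)
      ∧ ∫ s in (0 : ℝ)..1,
            |∑' k : ℤ, ∫ u : ℝ, f u * g (s + k - u) * (1 - c (F u, G (s + k - u)))|
          ≤ ∫ p in Set.Icc (0 : ℝ) 1 ×ˢ Set.Icc (0 : ℝ) 1, |1 - c p| := by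
  obtain ⟨hFm, hFmap⟩ := aux_map_cdf f F hf hf0 hf1 hF
  obtain ⟨hGm, hGmap⟩ := aux_map_cdf g G hg hg0 hg1 hG
  set H : ℝ × ℝ → ENNReal := fun p => ENNReal.ofReal (f p.1 * g p.2 * |1 - c (F p.1, G p.2)|)
    with hH
  have hHm : Measurable H := by
    have : Measurable fun p : ℝ × ℝ => c (F p.1, G p.2) := by fun_prop
    have : Measurable fun p : ℝ × ℝ => |1 - c (F p.1, G p.2)| := by
      exact (measurable_const.sub this).norm
    fun_prop
  set R : ℝ := ∫ p in Set.Icc (0 : ℝ) 1 ×ˢ Set.Icc (0 : ℝ) 1, |1 - c p| with hR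
  have habsm : Measurable fun p : ℝ × ℝ => |1 - c p| := by
    exact (measurable_const.sub hc).norm
  set φ : ℝ → ENNReal := fun s => ∫⁻ u, H (u, s - u) with hφdef
  have hφ : Measurable φ := by
    have : Measurable fun p : ℝ × ℝ => H (p.2, p.1 - p.2) := by fun_prop
    exact this.lintegral_prod_right'
  have hfin : IsFiniteMeasure (volume.withDensity (fun x => ENNReal.ofReal (g x))) := by
    constructor
    rw [← Set.preimage_univ (f := G), ← Measure.map_apply hGm MeasurableSet.univ, hGmap]
    simp
  have hfin' : IsFiniteMeasure (volume.withDensity (fun x => ENNReal.ofReal (f x))) := by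
    constructor
    rw [← Set.preimage_univ (f := F), ← Measure.map_apply hFm MeasurableSet.univ, hFmap]
    simp
  have htotal : ∫⁻ s, φ s = ENNReal.ofReal R := by
    calc ∫⁻ s, φ s = ∫⁻ u, ∫⁻ s, H (u, s - u) := by
          rw [hφdef]
          apply lintegral_lintegral_swap
          have : Measurable fun p : ℝ × ℝ => H (p.2, p.1 - p.2) := by fun_prop
          exact this.aemeasurable
      _ = ∫⁻ u, ∫⁻ v, H (u, v) := by
          refine lintegral_congr (fun u => ?_)
          exact lintegral_sub_right_eq_self (fun v => H (u, v)) u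
      _ = ∫⁻ p, H p := by
          rw [Measure.volume_eq_prod, lintegral_prod _ hHm.aemeasurable]
      _ = ∫⁻ p, ENNReal.ofReal |1 - c (Prod.map F G p)|
            ∂((volume.withDensity (fun x => ENNReal.ofReal (f x))).prod
              (volume.withDensity (fun x => ENNReal.ofReal (g x)))) := by
          rw [prod_withDensity (by fun_prop) (by fun_prop),
            lintegral_withDensity_eq_lintegral_mul _ (by fun_prop)
              (show Measurable fun p => ENNReal.ofReal |1 - c (Prod.map F G p)| from
                (habsm.comp (hFm.prodMap hGm)).ennreal_ofReal)]
          refine lintegral_congr (fun p => ?_)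
          simp only [hH, Pi.mul_apply, Prod.map]
          rw [ENNReal.ofReal_mul (mul_nonneg (hf0 _) (hg0 _)), ENNReal.ofReal_mul (hf0 _)]
      _ = ∫⁻ p, ENNReal.ofReal |1 - c p| ∂((volume.restrict (Set.Icc (0:ℝ) 1)).prod
            (volume.restrict (Set.Icc (0:ℝ) 1))) := by
          rw [show (volume.restrict (Set.Icc (0:ℝ) 1)).prod (volume.restrict (Set.Icc (0:ℝ) 1)) =
              ((volume.withDensity (fun x => ENNReal.ofReal (f x))).map F).prod
              ((volume.withDensity (fun x => ENNReal.ofReal (g x))).map G) by rw [hFmap, hGmap],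
            Measure.map_prod_map _ _ hFm hGm,
            lintegral_map habsm.ennreal_ofReal (hFm.prodMap hGm)]
      _ = ENNReal.ofReal R := by
          rw [Measure.prod_restrict, ← Measure.volume_eq_prod, hR,
            ofReal_integral_eq_lintegral_ofReal hcint (ae_of_all _ fun p => abs_nonneg _)]
  set A : ℝ → ENNReal := fun s => ∑' k : ℤ, φ (s + k) with hA
  have hAm : Measurable A := by
    exact Measurable.ennreal_tsum (fun k => by fun_prop)
  have hAint : ∫⁻ s in Set.Ioc (0:ℝ) 1, A s = ENNReal.ofReal R := by
    rw [hA, aux_tile φ hφ, htotal]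
  have hAfin : ∀ᵐ s ∂(volume.restrict (Set.Ioc (0 : ℝ) 1)), A s < ⊤ :=
    ae_lt_top hAm (by rw [hAint]; exact ENNReal.ofReal_ne_top)
  have hR0 : 0 ≤ R := integral_nonneg fun p => abs_nonneg _
  have hsm : ∀ s : ℝ, Measurable fun u => f u * g (s - u) * (1 - c (F u, G (s - u))) := by
    intro s; fun_prop
  have hint : ∀ s : ℝ, ∫ u, f u * g (s - u) * |1 - c (F u, G (s - u))| = (φ s).toReal := by
    intro s
    rw [integral_eq_lintegral_of_nonneg_ae
      (ae_of_all _ fun u => mul_nonneg (mul_nonneg (hf0 _) (hg0 _)) (abs_nonneg _))]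
    have h1 : Measurable fun u => |1 - c (F u, G (s - u))| :=
      habsm.comp (by fun_prop : Measurable fun u => (F u, G (s - u)))
    exact (by fun_prop : Measurable fun u =>
      f u * g (s - u) * |1 - c (F u, G (s - u))|).aestronglyMeasurable
  have hbd : ∀ s : ℝ, ‖∫ u, f u * g (s - u) * (1 - c (F u, G (s - u)))‖ ≤ (φ s).toReal := by
    intro s
    rw [← hint s]
    refine (norm_integral_le_integral_norm _).trans_eq (integral_congr_ae (ae_of_all _ fun u => ?_))
    simp only [Real.norm_eq_abs, abs_mul, abs_of_nonneg (hf0 _), abs_of_nonneg (hg0 _)]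
  constructor
  · rw [← restrict_Ioc_eq_restrict_Icc]
    filter_upwards [hAfin] with s hs
    simp only [hint]
    exact ENNReal.summable_toReal hs.ne
  · rw [intervalIntegral.integral_of_le zero_le_one]
    have hAR : ∫ s in Set.Ioc (0:ℝ) 1, (A s).toReal = R := by
      rw [integral_toReal hAm.aemeasurable hAfin, hAint, ENNReal.toReal_ofReal hR0]
    rw [← hAR]
    refine integral_mono_of_nonneg (ae_of_all _ fun s => abs_nonneg _)
      (integrable_toReal_of_lintegral_ne_top hAm.aemeasurable
        (by rw [hAint]; exact ENNReal.ofReal_ne_top)) ?_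
    filter_upwards [hAfin] with s hs
    have hsum := ENNReal.summable_toReal hs.ne
    rw [hA, ENNReal.tsum_toReal_eq (fun k => ENNReal.ne_top_of_tsum_ne_top hs.ne k)]
    have hn : Summable fun k : ℤ =>
        ‖∫ u : ℝ, f u * g (s + k - u) * (1 - c (F u, G (s + k - u)))‖ :=
      Summable.of_nonneg_of_le (fun k => norm_nonneg _) (fun k => hbd _) hsum
    exact (norm_tsum_le_tsum_norm hn).trans (hn.tsum_le_tsum (fun k => hbd _) hsum)
end

section
/- Let n ≥ 2, let f₁, …, fₙ be probability density functions on ℝ with cumulative distribution functions F₁, …, Fₙ, and let c : [0,1]ⁿ → [0,∞) be a copula density on [0,1]ⁿ with ∫_{[0,1]ⁿ} |1 − c| < ∞. For s ∈ [0,1], k ∈ ℤ and (u₁, …, u_{n−1}) ∈ ℝ^{n−1}, write uₙ⁰ = s + k − (u₁ + ⋯ + u_{n−1}). Then ∫₀^1 | ∑_{k∈ℤ} ∫_{ℝ^{n−1}} ( ∏_{i=1}^{n−1} fᵢ(uᵢ) ) fₙ(uₙ⁰) ( 1 − c(F₁(u₁), …, F_{n−1}(u_{n−1}), Fₙ(uₙ⁰))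 ) du₁ ⋯ du_{n−1} | ds ≤ ∫_{[0,1]ⁿ} |1 − c(u₁, …, uₙ)| du₁ ⋯ duₙ. -/
open MeasureTheory

lemma aux_pit (f : ℝ → ℝ) (hf0 : ∀ x, 0 ≤ f x)
    (hf1 : ∫ x, f x = 1) (F : ℝ → ℝ) (hF : ∀ x, F x = ∫ u in Set.Iic x, f u) :
    Continuous F ∧ Measure.map F (volume.withDensity fun x => ENNReal.ofReal (f x))
      = volume.restrict (Set.Icc (0:ℝ) 1) := by
  have hint : Integrable f := by
    by_contra h
    rw [integral_undef h] at hf1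
    exact zero_ne_one hf1
  have hcont : Continuous F := by
    have : F = fun x => F 0 + ∫ u in (0:ℝ)..x, f u := by
      funext x
      rw [hF, hF, ← intervalIntegral.integral_Iic_sub_Iic hint.integrableOn hint.integrableOn]
      ring
    rw [this]
    exact continuous_const.add (hint.continuous_primitive 0)
  refine ⟨hcont, ?_⟩
  set μ : Measure ℝ := volume.withDensity fun x => ENNReal.ofReal (f x) with hμ
  have hIic : ∀ x, μ (Set.Iic x) = ENNReal.ofReal (F x) := by
    intro x
    rw [hμ, withDensity_apply _ measurableSet_Iic, hF,
      ofReal_integral_eq_lintegral_ofReal hint.integrableOn (ae_of_all _ hf0)]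
  have hprob : IsProbabilityMeasure μ := by
    constructor
    rw [hμ, withDensity_apply _ MeasurableSet.univ, Measure.restrict_univ,
      ← ofReal_integral_eq_lintegral_ofReal hint (ae_of_all _ hf0), hf1]
    simp
  have hF0 : ∀ x, 0 ≤ F x := fun x => by
    rw [hF]; exact integral_nonneg hf0
  have hFc : F = ProbabilityTheory.cdf μ := by
    funext x
    rw [ProbabilityTheory.cdf_eq_real, measureReal_def, hIic, ENNReal.toReal_ofReal (hF0 x)]
  have hmono : Monotone F := hFc ▸ ProbabilityTheory.monotone_cdf μ
  have hbot : Filter.Tendsto F Filter.atBot (nhds 0) := hFc ▸ ProbabilityTheory.tendsto_cdf_atBot μ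
  have htop : Filter.Tendsto F Filter.atTop (nhds 1) := hFc ▸ ProbabilityTheory.tendsto_cdf_atTop μ
  have hle1 : ∀ x, F x ≤ 1 := fun x => hFc ▸ ProbabilityTheory.cdf_le_one μ x
  haveI : IsFiniteMeasure (Measure.map F μ) := inferInstance
  refine Measure.ext_of_Iic _ _ fun y => ?_
  rw [Measure.map_apply hcont.measurable measurableSet_Iic,
    Measure.restrict_apply measurableSet_Iic]
  rcases lt_or_ge y 0 with hy | hy
  · have h1 : F ⁻¹' Set.Iic y = ∅ := by
      ext x; simpa using lt_of_lt_of_le hy (hF0 x)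
    have h2 : Set.Iic y ∩ Set.Icc (0:ℝ) 1 = ∅ := by
      ext x; simp; intro a b; linarith
    rw [h1, h2]; simp
  rcases le_or_gt 1 y with hy1 | hy1
  · have h1 : F ⁻¹' Set.Iic y = Set.univ := by
      ext x; simpa using (hle1 x).trans hy1
    have h2 : Set.Iic y ∩ Set.Icc (0:ℝ) 1 = Set.Icc 0 1 := by
      ext x; simp; intro a b; linarith
    rw [h1, h2]; simp
  have h2 : Set.Iic y ∩ Set.Icc (0:ℝ) 1 = Set.Icc 0 y := by
    ext x; simp only [Set.mem_inter_iff, Set.mem_Iic, Set.mem_Icc]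
    constructor
    · rintro ⟨a, b, c⟩; exact ⟨b, a⟩
    · rintro ⟨a, b⟩; exact ⟨b, a, by linarith⟩
  rw [h2, Real.volume_Icc, sub_zero]
  rcases (F ⁻¹' Set.Iic y).eq_empty_or_nonempty with he | hne
  · rw [he]
    have : y ≤ 0 := ge_of_tendsto hbot (Filter.Eventually.of_forall fun x => by
      have : x ∉ F ⁻¹' Set.Iic y := by rw [he]; simp
      simp at this
      exact this.le)
    simp [this]
  obtain ⟨b, hb⟩ := (htop.eventually (lt_mem_nhds hy1)).exists
  have hbdd : BddAbove (F ⁻¹' Set.Iic y) := ⟨b, fun x hx => by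
    by_contra h
    have := hmono (not_le.1 h).le
    simp at hx
    linarith⟩
  have hcl : IsClosed (F ⁻¹' Set.Iic y) := isClosed_Iic.preimage hcont
  have hmem := hcl.csSup_mem hne hbdd
  set x0 := sSup (F ⁻¹' Set.Iic y) with hx0
  have hS : F ⁻¹' Set.Iic y = Set.Iic x0 := by
    ext x
    constructor
    · intro hx; exact le_csSup hbdd hx
    · intro hx; exact (hmono hx).trans hmem
  rw [hS, hIic]
  congr 1
  refine le_antisymm hmem ?_
  refine ge_of_tendsto (hcont.continuousAt.tendsto.mono_left nhdsWithin_le_nhds :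
    Filter.Tendsto F (nhdsWithin x0 (Set.Ioi x0)) (nhds (F x0))) ?_
  filter_upwards [self_mem_nhdsWithin] with x hx
  by_contra h
  have : x ∈ F ⁻¹' Set.Iic y := (not_le.1 h).le
  rw [hS] at this
  exact (not_lt.2 (Set.mem_Iic.1 this)) (Set.mem_Ioi.1 hx)

lemma aux_pi {m : ℕ} (f : Fin m → ℝ → ℝ) (hf : ∀ i, Measurable (f i))
    (hf0 : ∀ i x, 0 ≤ f i x) (hint : ∀ i, Integrable (f i)) :
    Measure.pi (fun i => volume.withDensity fun x => ENNReal.ofReal (f i x))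
      = (volume : Measure (Fin m → ℝ)).withDensity
          fun x => ENNReal.ofReal (∏ i, f i (x i)) := by
  haveI : ∀ i, IsFiniteMeasure (volume.withDensity fun x => ENNReal.ofReal (f i x)) :=
    fun i => isFiniteMeasure_withDensity_ofReal (hint i).2
  refine Measure.pi_eq fun s hs => ?_
  rw [withDensity_apply _ (MeasurableSet.univ_pi hs), volume_pi, Measure.restrict_pi_pi,
    ← ofReal_integral_eq_lintegral_ofReal
      (Integrable.fintype_prod (fun i => (hint i).integrableOn (s := s i)))
      (ae_of_all _ fun x => Finset.prod_nonneg fun i _ => hf0 i _),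
    integral_fintype_prod_eq_prod, ENNReal.ofReal_prod_of_nonneg
      (fun i _ => integral_nonneg (hf0 i))]
  refine Finset.prod_congr rfl fun i _ => ?_
  rw [withDensity_apply _ (hs i), ofReal_integral_eq_lintegral_ofReal (hint i).integrableOn
    (ae_of_all _ (hf0 i))]

lemma aux_tsum (h : ℝ → ENNReal) (hh : Measurable h) :
    ∫⁻ s in Set.Ioc (0:ℝ) 1, ∑' k : ℤ, h (s + k) = ∫⁻ t, h t := by
  rw [lintegral_tsum (fun k => by fun_prop), ← setLIntegral_univ h, ← iUnion_Ioc_intCast ℝ,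
    lintegral_iUnion (fun _ => measurableSet_Ioc) (Set.pairwise_disjoint_Ioc_intCast ℝ)]
  refine tsum_congr fun k => ?_
  rw [← lintegral_indicator measurableSet_Ioc, ← lintegral_indicator measurableSet_Ioc,
    ← lintegral_add_right_eq_self ((Set.Ioc (k:ℝ) (k+1)).indicator h) (k : ℝ)]
  refine lintegral_congr fun s => ?_
  simp only [Set.indicator, Set.mem_Ioc]
  congr 1
  apply propext
  constructor <;> rintro ⟨a, b⟩ <;> constructor <;> linarith

lemma aux_snoc (n : ℕ) (G : (Fin (n + 2) → ℝ) → ENNReal) (hG : Measurable G) :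
    ∫⁻ s in Set.Ioc (0:ℝ) 1, ∑' k : ℤ, ∫⁻ u : Fin (n + 1) → ℝ,
      G (Fin.snoc u (s + k - ∑ i, u i) : Fin (n + 2) → ℝ) = ∫⁻ x, G x := by
  have hsn : Measurable fun p : (Fin (n+1) → ℝ) × ℝ => (Fin.snoc p.1 p.2 : Fin (n+2) → ℝ) := by
    refine measurable_pi_iff.2 fun j => ?_
    refine Fin.lastCases ?_ (fun i => ?_) j
    · simpa using measurable_snd
    · simp only [Fin.snoc_castSucc]; fun_prop
  have h2 : Measurable fun p : ℝ × (Fin (n+1) → ℝ) =>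
      G (Fin.snoc p.2 (p.1 - ∑ i, p.2 i) : Fin (n + 2) → ℝ) :=
    hG.comp (hsn.comp (f := fun p : ℝ × (Fin (n+1) → ℝ) => (p.2, p.1 - ∑ i, p.2 i))
      (by fun_prop))
  rw [aux_tsum (fun t => ∫⁻ u : Fin (n + 1) → ℝ,
      G (Fin.snoc u (t - ∑ i, u i) : Fin (n + 2) → ℝ)) h2.lintegral_prod_right',
    lintegral_lintegral_swap h2.aemeasurable,
    ← (volume_preserving_piFinSuccAbove (fun _ : Fin (n+2) => ℝ)
      (Fin.last _)).symm.lintegral_comp_emb (MeasurableEquiv.measurableEmbedding _) G]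
  have h3 : Measurable fun p : ℝ × (Fin (n+1) → ℝ) => G ((MeasurableEquiv.piFinSuccAbove
      (fun _ : Fin (n+2) => ℝ) (Fin.last (n+1))).symm p) :=
    hG.comp (MeasurableEquiv.measurable _)
  rw [show (volume : Measure (ℝ × (Fin (n+1) → ℝ))) = volume.prod volume from rfl]
  refine Eq.trans ?_ (lintegral_prod_symm _ h3.aemeasurable).symm
  refine lintegral_congr fun u => ?_
  rw [lintegral_sub_right_eq_self (fun t => G (Fin.snoc u t : Fin (n + 2) → ℝ)) (∑ i, u i)]
  refine lintegral_congr fun t => ?_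
  congr 1
  exact (Fin.insertNth_last' (β := ℝ) t u).symm

theorem stmt12 (n : ℕ) (f : Fin (n + 2) → ℝ → ℝ) (hf : ∀ i, Measurable (f i))
    (hf0 : ∀ i x, 0 ≤ f i x) (hf1 : ∀ i, ∫ x, f i x = 1)
    (F : Fin (n + 2) → ℝ → ℝ) (hF : ∀ i x, F i x = ∫ u in Set.Iic x, f i u)
    (c : (Fin (n + 2) → ℝ) → ℝ) (hc : Measurable c) (hc0 : ∀ u, 0 ≤ c u)
    (hcnorm : ∫ u in Set.Icc (0 : Fin (n + 2) → ℝ) 1, c u = 1)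
    (hmarg : ∀ i : Fin (n + 2),
      ∀ᵐ t ∂(volume.restrict (Set.Icc (0 : ℝ) 1)),
        ∫ u in Set.Icc (0 : Fin (n + 1) → ℝ) 1, c (Fin.insertNth i t u) = 1)
    (hcint : IntegrableOn (fun u => |1 - c u|) (Set.Icc (0 : Fin (n + 2) → ℝ) 1)) :
    ∫ s in (0 : ℝ)..1,
        |∑' k : ℤ, ∫ u : Fin (n + 1) → ℝ,
          (∏ j : Fin (n + 2), f j ((Fin.snoc u (s + k - ∑ i, u i) : Fin (n + 2) → ℝ) j))
            * (1 - c (fun j => F j ((Fin.snoc u (s + k - ∑ i, u i) : Fin (n + 2) → ℝ) j)))|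
      ≤ ∫ u in Set.Icc (0 : Fin (n + 2) → ℝ) 1, |1 - c u| := by
  have hint : ∀ i, Integrable (f i) := fun i => by
    by_contra h
    have := hf1 i
    rw [integral_undef h] at this
    exact zero_ne_one this
  have hpit := fun i => aux_pit (f i) (hf0 i) (hf1 i) (F i) (hF i)
  haveI : ∀ i, IsFiniteMeasure (volume.withDensity fun x => ENNReal.ofReal (f i x)) :=
    fun i => isFiniteMeasure_withDensity_ofReal (hint i).2
  have hFm : ∀ i, Measurable (F i) := fun i => (hpit i).1.measurable
  have hmap : Measure.map (fun (x : Fin (n+2) → ℝ) j => F j (x j))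
      ((volume : Measure (Fin (n+2) → ℝ)).withDensity
          fun x => ENNReal.ofReal (∏ i, f i (x i)))
      = volume.restrict (Set.Icc (0 : Fin (n + 2) → ℝ) 1) := by
    haveI : ∀ i, SigmaFinite
        (Measure.map (F i) (volume.withDensity fun x => ENNReal.ofReal (f i x))) := fun i => by
      rw [(hpit i).2]; infer_instance
    rw [← aux_pi f hf hf0 hint, Measure.pi_map_pi (fun i => (hFm i).aemeasurable),
      ← Set.pi_univ_Icc, volume_pi, Measure.restrict_pi_pi]
    congr 1
    funext i
    exact (hpit i).2
  have hFF : Measurable (fun (x : Fin (n+2) → ℝ) j => F j (x j)) :=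
    measurable_pi_iff.2 fun j => (hFm j).comp (measurable_pi_apply j)
  have hp : Measurable fun x : Fin (n+2) → ℝ => ∏ i, f i (x i) :=
    Finset.measurable_prod _ fun i _ => (hf i).comp (measurable_pi_apply i)
  have hcF : Measurable fun x : Fin (n+2) → ℝ => 1 - c (fun j => F j (x j)) :=
    measurable_const.sub (hc.comp hFF)
  set H : (Fin (n+2) → ℝ) → ℝ := fun x => (∏ i, f i (x i)) * (1 - c (fun j => F j (x j))) with hH
  have hHm : Measurable H := hp.mul hcF
  have key : ∫⁻ x, ‖H x‖ₑ = ∫⁻ u in Set.Icc (0 : Fin (n + 2) → ℝ) 1, ENNReal.ofReal |1 - c u| := by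
    rw [← hmap, lintegral_map (by fun_prop) hFF,
      lintegral_withDensity_eq_lintegral_mul _ hp.ennreal_ofReal (by fun_prop)]
    refine lintegral_congr fun x => ?_
    simp only [hH, Pi.mul_apply, enorm_mul]
    rw [Real.enorm_of_nonneg (Finset.prod_nonneg fun i _ => hf0 i _), Real.enorm_eq_ofReal_abs]
  rw [intervalIntegral.integral_of_le zero_le_one]
  have hR : 0 ≤ ∫ u in Set.Icc (0 : Fin (n + 2) → ℝ) 1, |1 - c u| :=
    integral_nonneg fun u => abs_nonneg _
  refine (le_abs_self _).trans ?_
  rw [← Real.norm_eq_abs, ← ENNReal.ofReal_le_ofReal_iff hR, ofReal_norm_eq_enorm]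
  refine (enorm_integral_le_lintegral_enorm _).trans ?_
  rw [ofReal_integral_eq_lintegral_ofReal hcint (ae_of_all _ fun u => abs_nonneg _), ← key,
    ← aux_snoc n (fun x => ‖H x‖ₑ) hHm.enorm]
  refine lintegral_mono fun s => ?_
  rw [← Real.norm_eq_abs, enorm_norm]
  refine enorm_tsum_le_tsum_enorm.trans ?_
  exact ENNReal.tsum_le_tsum fun k => enorm_integral_le_lintegral_enorm _
end

section
/- Let B > 1 be a real number, let (Ω, ℙ) be a probability space, and let X, Y : Ω → (0,∞) be independent random variables. Suppose the pushforward of ℙ under ω ↦ fract(log_B X(ω)) is Lebesgue measure restricted to [0,1). Then the pushforward of ℙ under ω ↦ fract(log_B (X(ω) · Y(ω))) is also Lebesgue measure restricted to [0,1). -/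
open MeasureTheory

theorem fract_shift_aux (c : ℝ) (s : Set ℝ) (hs : MeasurableSet s) :
    volume.restrict (Set.Ico (0 : ℝ) 1) ((fun u => Int.fract (u + c)) ⁻¹' s)
      = volume.restrict (Set.Ico (0 : ℝ) 1) s := by
  have hA : MeasurableSet (Int.fract ⁻¹' s : Set ℝ) := measurable_fract hs
  have hm : Measurable (fun u : ℝ => Int.fract (u + c)) :=
    measurable_fract.comp (measurable_id.add_const c)
  have h1 := (isAddFundamentalDomain_Ioc (one_pos : (0:ℝ) < 1) c volume).measure_set_eq
    (isAddFundamentalDomain_Ioc (one_pos : (0:ℝ) < 1) 0 volume) hA (by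
      rintro ⟨g, hg⟩
      obtain ⟨n, rfl⟩ := AddSubgroup.mem_zmultiples_iff.mp hg
      ext x
      simp [AddSubgroup.vadd_def])
  rw [Measure.restrict_apply (hm hs), Measure.restrict_apply hs]
  have h2 : (fun u => Int.fract (u + c)) ⁻¹' s ∩ Set.Ico (0:ℝ) 1
      = (fun u => u + c) ⁻¹' (Int.fract ⁻¹' s ∩ Set.Ico c (c + 1)) := by
    ext u
    simp only [Set.mem_inter_iff, Set.mem_preimage, Set.mem_Ico]
    constructor
    · rintro ⟨a, b, d⟩
      exact ⟨a, by linarith, by linarith⟩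
    · rintro ⟨a, b, d⟩
      exact ⟨a, by linarith, by linarith⟩
  have h3 : s ∩ Set.Ico (0:ℝ) 1 = Int.fract ⁻¹' s ∩ Set.Ico (0:ℝ) 1 := by
    ext u
    simp only [Set.mem_inter_iff, Set.mem_preimage, Set.mem_Ico]
    refine and_congr_left fun h => ?_
    rw [Int.fract_eq_self.mpr h]
  have h4 : ∀ a b : ℝ, volume (Int.fract ⁻¹' s ∩ Set.Ico a b)
      = volume (Int.fract ⁻¹' s ∩ Set.Ioc a b) := fun a b =>
    measure_congr (Filter.EventuallyEq.rfl.inter Ico_ae_eq_Ioc)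
  rw [h2, measure_preimage_add_right, h3, h4, h4, h1, zero_add]

/-- The absorptive property of Benford's law (Theorem 2.4): if `X` and `Y` are independent
positive random variables and `X` satisfies the strong Benford's law base `B` (i.e. the law
of `fract(log_B X)` is the uniform distribution on `[0,1)`), then the product `XY` also
satisfies the strong Benford's law base `B`. -/
theorem stmt14 {Ω : Type*} [MeasurableSpace Ω] (P : Measure Ω) [IsProbabilityMeasure P]
    (B : ℝ) (hB : 1 < B) (X Y : Ω → ℝ) (hX : Measurable X) (hY : Measurable Y)
    (hXpos : ∀ ω, 0 < X ω) (hYpos : ∀ ω, 0 < Y ω)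
    (hindep : ProbabilityTheory.IndepFun X Y P)
    (hXBenford : Measure.map (fun ω => Int.fract (Real.logb B (X ω))) P
      = volume.restrict (Set.Ico (0 : ℝ) 1)) :
    Measure.map (fun ω => Int.fract (Real.logb B (X ω * Y ω))) P
      = volume.restrict (Set.Ico (0 : ℝ) 1) := by
  have hlm : Measurable (Real.logb B) := by
    unfold Real.logb
    fun_prop
  have hU : Measurable (fun ω => Int.fract (Real.logb B (X ω))) :=
    measurable_fract.comp (hlm.comp hX)
  have hV : Measurable (fun ω => Real.logb B (Y ω)) := hlm.comp hY
  have hi : ProbabilityTheory.IndepFun (fun ω => Int.fract (Real.logb B (X ω)))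
      (fun ω => Real.logb B (Y ω)) P := hindep.comp (measurable_fract.comp hlm) hlm
  have hprod := (ProbabilityTheory.indepFun_iff_map_prod_eq_prod_map_map
    hU.aemeasurable hV.aemeasurable).mp hi
  have hF : Measurable (fun p : ℝ × ℝ => Int.fract (p.1 + p.2)) :=
    measurable_fract.comp (measurable_fst.add measurable_snd)
  have heq : (fun ω => Int.fract (Real.logb B (X ω * Y ω)))
      = (fun p : ℝ × ℝ => Int.fract (p.1 + p.2)) ∘
        (fun ω => (Int.fract (Real.logb B (X ω)), Real.logb B (Y ω))) := by
    funext ω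
    simp only [Function.comp]
    rw [Real.logb_mul (hXpos ω).ne' (hYpos ω).ne', Int.fract_eq_fract]
    exact ⟨⌊Real.logb B (X ω)⌋, by rw [Int.fract]; ring⟩
  have : IsProbabilityMeasure (Measure.map (fun ω => Real.logb B (Y ω)) P) :=
    Measure.isProbabilityMeasure_map hV.aemeasurable
  rw [heq, ← Measure.map_map hF (hU.prodMk hV), hprod, hXBenford]
  ext s hs
  rw [Measure.map_apply hF hs, Measure.prod_apply_symm (hF hs)]
  have h5 : ∀ y : ℝ, volume.restrict (Set.Ico (0 : ℝ) 1)
      ((fun x => (x, y)) ⁻¹' ((fun p : ℝ × ℝ => Int.fract (p.1 + p.2)) ⁻¹' s))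
      = volume.restrict (Set.Ico (0 : ℝ) 1) s := fun y => fract_shift_aux y s hs
  simp only [h5, lintegral_const, measure_univ, mul_one]
end

section
/- Let C : [0,1]² → ℝ satisfy: (grounded) C(u, 0) = C(0, v) = 0 for all u, v ∈ [0,1]; (margins) C(u, 1) = u and C(1, v) = v for all u, v ∈ [0,1]; and (2-increasing) C(u₂, v₂) − C(u₂, v₁) − C(u₁, v₂) + C(u₁, v₁) ≥ 0 whenever 0 ≤ u₁ ≤ u₂ ≤ 1 and 0 ≤ v₁ ≤ v₂ ≤ 1. Let F, G : ℝ → [0,1] be nondecreasing functions with F(x) → 0 as x → −∞, F(x) → 1 as x → +∞, and likewise for G. Define H(x, y) = C(F(x), G(y)). Then: (i) H is 2-increasing, i.e., H(x₂, y₂) − H(x₂, y₁) − H(x₁, y₂) + H(x₁, y₁) ≥ 0 whenever x₁ ≤ x₂ and y₁ ≤ y₂; (ii) for each fixed y, H(x, y) → 0 as x → −∞, and for each fixed x, H(x, y) → 0 as y → −∞; (iii) for each fixed x, H(x, y) → F(x) as y → +∞, and for each fixed y, H(x, y) → G(y) as x → +∞. -/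
open Filter

/-- The converse direction of Sklar's Theorem in two dimensions: if `C` is a 2-copula
(grounded, with uniform margins, and 2-increasing) and `F, G` are cumulative distribution
functions, then `H(x,y) = C(F(x), G(y))` is 2-increasing, vanishes in the limit as either
argument goes to `−∞`, and has margins `F` and `G` in the limits as the other argument goes
to `+∞`. -/
theorem stmt16 (C : ℝ → ℝ → ℝ)
    (hground1 : ∀ u ∈ Set.Icc (0 : ℝ) 1, C u 0 = 0)
    (hground2 : ∀ v ∈ Set.Icc (0 : ℝ) 1, C 0 v = 0)
    (hmarg1 : ∀ u ∈ Set.Icc (0 : ℝ) 1, C u 1 = u)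
    (hmarg2 : ∀ v ∈ Set.Icc (0 : ℝ) 1, C 1 v = v)
    (hincr : ∀ u₁ u₂ v₁ v₂ : ℝ, 0 ≤ u₁ → u₁ ≤ u₂ → u₂ ≤ 1 → 0 ≤ v₁ → v₁ ≤ v₂ → v₂ ≤ 1 →
      0 ≤ C u₂ v₂ - C u₂ v₁ - C u₁ v₂ + C u₁ v₁)
    (F G : ℝ → ℝ)
    (hFmono : Monotone F) (hFrange : ∀ x, F x ∈ Set.Icc (0 : ℝ) 1)
    (hFbot : Tendsto F atBot (nhds 0)) (hFtop : Tendsto F atTop (nhds 1))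
    (hGmono : Monotone G) (hGrange : ∀ y, G y ∈ Set.Icc (0 : ℝ) 1)
    (hGbot : Tendsto G atBot (nhds 0)) (hGtop : Tendsto G atTop (nhds 1))
    (H : ℝ → ℝ → ℝ) (hH : ∀ x y, H x y = C (F x) (G y)) :
    (∀ x₁ x₂ y₁ y₂ : ℝ, x₁ ≤ x₂ → y₁ ≤ y₂ →
        0 ≤ H x₂ y₂ - H x₂ y₁ - H x₁ y₂ + H x₁ y₁)
      ∧ (∀ y, Tendsto (fun x => H x y) atBot (nhds 0))
      ∧ (∀ x, Tendsto (fun y => H x y) atBot (nhds 0))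
      ∧ (∀ x, Tendsto (fun y => H x y) atTop (nhds (F x)))
      ∧ (∀ y, Tendsto (fun x => H x y) atTop (nhds (G y))) := by
  have z0 : (0:ℝ) ∈ Set.Icc (0:ℝ) 1 := ⟨le_rfl, zero_le_one⟩
  have z1 : (1:ℝ) ∈ Set.Icc (0:ℝ) 1 := ⟨zero_le_one, le_rfl⟩
  have key : ∀ x y, 0 ≤ H x y ∧ H x y ≤ F x ∧ H x y ≤ G y ∧ F x + G y - 1 ≤ H x y := by
    intro x y
    rw [hH]
    have hu := hFrange x
    have hv := hGrange y
    have a1 := hincr 0 (F x) 0 (G y) le_rfl hu.1 hu.2 le_rfl hv.1 hv.2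
    have a2 := hincr 0 (F x) (G y) 1 le_rfl hu.1 hu.2 hv.1 hv.2 le_rfl
    have a3 := hincr (F x) 1 0 (G y) hu.1 hu.2 le_rfl le_rfl hv.1 hv.2
    have a4 := hincr (F x) 1 (G y) 1 hu.1 hu.2 le_rfl hv.1 hv.2 le_rfl
    have b1 := hground1 _ hu
    have b2 := hground2 _ hv
    have b3 := hmarg1 _ hu
    have b4 := hmarg2 _ hv
    have b5 := hground1 _ z0
    have b6 := hground1 _ z1
    have b7 := hground2 _ z1
    have b8 := hmarg1 _ z1
    refine ⟨?_, ?_, ?_, ?_⟩ <;> linarith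
  refine ⟨?_, ?_, ?_, ?_, ?_⟩
  · intro x₁ x₂ y₁ y₂ hx hy
    simp only [hH]
    exact hincr _ _ _ _ (hFrange _).1 (hFmono hx) (hFrange _).2 (hGrange _).1 (hGmono hy)
      (hGrange _).2
  · intro y
    exact squeeze_zero (fun x => (key x y).1) (fun x => (key x y).2.1) hFbot
  · intro x
    exact squeeze_zero (fun y => (key x y).1) (fun y => (key x y).2.2.1) hGbot
  · intro x
    have h : Tendsto (fun y => F x + G y - 1) atTop (nhds (F x)) := by
      simpa using (hGtop.const_add (F x)).sub_const 1
    exact tendsto_of_tendsto_of_tendsto_of_le_of_le h tendsto_const_nhds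
      (fun y => (key x y).2.2.2) (fun y => (key x y).2.1)
  · intro y
    have h : Tendsto (fun x => F x + G y - 1) atTop (nhds (G y)) := by
      simpa using (hFtop.add_const (G y)).sub_const 1
    exact tendsto_of_tendsto_of_tendsto_of_le_of_le h tendsto_const_nhds
      (fun x => (key x y).2.2.2) (fun x => (key x y).2.2.1)
end
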